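/- Let R be a commutative Noetherian ring, I and J ideals of R, M and N finitely generated R-modules, and i ≥ 0. If Tor_i^R(I^n M, J^m N) has finite length for all sufficiently large m and n, then there exist a polynomial p ∈ ℚ[x,y] and integers m₀, n₀ such that length_R(Tor_i^R(I^n M, J^m N)) = p(m,n) for all m ≥ m₀ and n ≥ n₀. -/

import Mathlib

open CategoryTheory

/-- `Tor_i^R(M, N)` as an object of `ModuleCat R`. -/
noncomputable def TorM (R : Type) [CommRing R] (i : ℕ)
    (M : Type) [AddCommGroup M] [Module R M]
    (N : Type) [AddCommGroup N] [Module R N] : ModuleCat R :=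
  ((Tor (ModuleCat R) i).obj (ModuleCat.of R M)).obj (ModuleCat.of R N)

/-- The length of a module: the Krull dimension of its lattice of submodules. -/
noncomputable def modLength (R : Type) [CommRing R]
    (M : Type) [AddCommGroup M] [Module R M] : WithBot ℕ∞ :=
  Order.krullDim (Submodule R M)

section Families

variable {R E Δ O : Type*} [CommRing R] [AddCommGroup E] [Module R E] [AddCommMonoid Δ]

/-- A family of submodules is stable when each operator `op o` carries the member of index `δ`
into the member of index `δ + e o`. -/
def IsStableFamily (op : O → Module.End R E) (e : O → Δ) (W : Δ → Submodule R E) : Prop :=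
  ∀ o δ z, z ∈ W δ → op o z ∈ W (δ + e o)

/-- A family of submodules is finitely generated when finitely many homogeneous elements of it
lie in no smaller stable family. -/
def FGFamily (op : O → Module.End R E) (e : O → Δ) (W : Δ → Submodule R E) : Prop :=
  ∃ s : Finset (Δ × E), (∀ p ∈ s, p.2 ∈ W p.1) ∧
    ∀ V, IsStableFamily op e V → (∀ p ∈ s, p.2 ∈ V p.1) → W ≤ V

/-- The operator induced by `op o` on finitely supported functions, shifting the index. -/
noncomputable def shiftOp (op : O → Module.End R E) (e : O → Δ) (o : O) :
    Module.End R (Δ →₀ E) :=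
  Finsupp.lmapDomain E R (· + e o) ∘ₗ Finsupp.mapRange.linearMap (op o)

lemma shiftOp_single (op : O → Module.End R E) (e : O → Δ) (o : O) (δ : Δ) (z : E) :
    shiftOp op e o (Finsupp.single δ z) = Finsupp.single (δ + e o) (op o z) := by
  simp [shiftOp, Finsupp.mapDomain_single]

lemma shiftOp_commute {op : O → Module.End R E} {e : O → Δ}
    (comm : ∀ o o', Commute (op o) (op o')) (o o' : O) :
    shiftOp op e o * shiftOp op e o' = shiftOp op e o' * shiftOp op e o := by
  refine Finsupp.lhom_ext fun δ z => ?_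
  have h : op o (op o' z) = op o' (op o z) := LinearMap.congr_fun (comm o o') z
  simp only [Module.End.mul_apply, shiftOp_single, h, add_right_comm]

/-- The algebra generated by the shifting operators. -/
noncomputable abbrev shiftAlgebra (op : O → Module.End R E) (e : O → Δ) :
    Subalgebra R (Module.End R (Δ →₀ E)) :=
  Algebra.adjoin R (Set.range (shiftOp op e))

open scoped IsMulCommutative in
lemma isNoetherianRing_shiftAlgebra [IsNoetherianRing R] [Finite O] {op : O → Module.End R E}
    {e : O → Δ} (comm : ∀ o o', Commute (op o) (op o')) :
    IsNoetherianRing (shiftAlgebra op e) := by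
  have : IsMulCommutative (shiftAlgebra op e) := Algebra.isMulCommutative_adjoin R (by
    rintro _ ⟨o, rfl⟩ _ ⟨o', rfl⟩
    exact shiftOp_commute comm o o')
  have : Algebra.FiniteType R (shiftAlgebra op e) :=
    (Subalgebra.fg_iff_finiteType _).1 (Subalgebra.fg_def.2 ⟨_, Set.finite_range _, rfl⟩)
  exact Algebra.FiniteType.isNoetherianRing R (shiftAlgebra op e)

/-- The module of finitely supported functions with values in a stable family. -/
noncomputable def IsStableFamily.total {op : O → Module.End R E} {e : O → Δ}
    {W : Δ → Submodule R E} (hW : IsStableFamily op e W) :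
    Submodule (shiftAlgebra op e) (Δ →₀ E) where
  carrier := {f | ∀ δ, f δ ∈ W δ}
  add_mem' hf hg δ := (W δ).add_mem (hf δ) (hg δ)
  zero_mem' δ := (W δ).zero_mem
  smul_mem' := by
    rintro ⟨c, hc⟩ f hf
    change ∀ δ, c f δ ∈ W δ
    replace hf : ∀ δ, f δ ∈ W δ := hf
    induction hc using Algebra.adjoin_induction generalizing f with
    | mem c hc =>
      obtain ⟨o, rfl⟩ := hc
      classical
      intro δ
      rw [← Finsupp.sum_single f, Finsupp.sum, map_sum, Finsupp.finsetSum_apply]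
      refine (W δ).sum_mem fun δ' _ => ?_
      rw [shiftOp_single, Finsupp.single_apply]
      split_ifs with h
      · exact h ▸ hW o δ' _ (hf δ')
      · exact (W δ).zero_mem
    | algebraMap r => exact fun δ => (W δ).smul_mem r (hf δ)
    | add c c' _ _ h h' => exact fun δ => (W δ).add_mem (h hf δ) (h' hf δ)
    | mul c c' _ _ h h' => exact h (h' hf)

lemma IsStableFamily.mem_total {op : O → Module.End R E} {e : O → Δ}
    {W : Δ → Submodule R E} (hW : IsStableFamily op e W) {f : Δ →₀ E} :
    f ∈ hW.total ↔ ∀ δ, f δ ∈ W δ := Iff.rfl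

lemma IsStableFamily.single_mem_total {op : O → Module.End R E} {e : O → Δ}
    {W : Δ → Submodule R E} (hW : IsStableFamily op e W) {δ : Δ} {z : E} :
    Finsupp.single δ z ∈ hW.total ↔ z ∈ W δ := by
  classical
  refine ⟨fun h => by simpa using hW.mem_total.1 h δ, fun h δ' => ?_⟩
  rw [Finsupp.single_apply]
  split_ifs with h'
  · exact h' ▸ h
  · exact (W δ').zero_mem

/-- The family of homogeneous components of a module of finitely supported functions. -/
lemma isStableFamily_comap (op : O → Module.End R E) (e : O → Δ)
    (T : Submodule (shiftAlgebra op e) (Δ →₀ E)) :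
    IsStableFamily op e fun δ => (T.restrictScalars R).comap (Finsupp.lsingle δ) := by
  intro o δ z hz
  have h := T.smul_mem ⟨shiftOp op e o, Algebra.subset_adjoin ⟨o, rfl⟩⟩ hz
  change shiftOp op e o (Finsupp.single δ z) ∈ T at h
  rwa [shiftOp_single] at h

lemma IsStableFamily.total_eq_span {op : O → Module.End R E} {e : O → Δ}
    {W : Δ → Submodule R E} (hW : IsStableFamily op e W) :
    hW.total = Submodule.span (shiftAlgebra op e)
      ((fun p : Δ × E => Finsupp.single p.1 p.2) '' {p | p.2 ∈ W p.1}) := by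
  refine le_antisymm (fun f hf => ?_) (Submodule.span_le.2 ?_)
  · rw [← Finsupp.sum_single f]
    exact Submodule.sum_mem _ fun δ _ => Submodule.subset_span ⟨(δ, f δ), hf δ, rfl⟩
  · rintro _ ⟨p, hp, rfl⟩
    exact hW.single_mem_total.2 hp

lemma IsStableFamily.fgFamily_of_fg_total {op : O → Module.End R E} {e : O → Δ}
    {V : Δ → Submodule R E} (hV : IsStableFamily op e V) (hfg : hV.total.FG) :
    FGFamily op e V := by
  classical
  rw [hV.total_eq_span, Submodule.fg_span_iff_fg_span_finset_subset] at hfg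
  obtain ⟨t, ht, heq⟩ := hfg
  obtain ⟨u, hu, rfl⟩ := Finset.subset_set_image_iff.1 ht
  refine ⟨u, fun p hp => hu hp, fun U hU hsub δ z hz => ?_⟩
  have h1 := hV.single_mem_total.2 hz
  rw [hV.total_eq_span, heq] at h1
  refine hU.single_mem_total.1 (Submodule.span_le.2 ?_ h1)
  intro x hx
  obtain ⟨p, hp, rfl⟩ := Finset.mem_image.1 (Finset.mem_coe.1 hx)
  exact hU.single_mem_total.2 (hsub p hp)

/-- Stable subfamilies of a finitely generated family are finitely generated. -/
theorem FGFamily.of_le [IsNoetherianRing R] [Finite O] {op : O → Module.End R E} {e : O → Δ}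
    (comm : ∀ o o', Commute (op o) (op o')) {W V : Δ → Submodule R E} (hW : FGFamily op e W)
    (hV : IsStableFamily op e V) (hVW : V ≤ W) : FGFamily op e V := by
  obtain ⟨s, -, hs⟩ := hW
  have := isNoetherianRing_shiftAlgebra (e := e) comm
  let g : Set (Δ →₀ E) := (fun p : Δ × E => Finsupp.single p.1 p.2) '' (s : Set (Δ × E))
  have hg : g.Finite := s.finite_toSet.image _
  have hGn : IsNoetherian (shiftAlgebra op e) (Submodule.span (shiftAlgebra op e) g) :=
    isNoetherian_span_of_finite (shiftAlgebra op e) hg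
  have hle : hV.total ≤ Submodule.span (shiftAlgebra op e) g := by
    have hWg := hs _ (isStableFamily_comap op e (Submodule.span (shiftAlgebra op e) g))
      fun q hq => Submodule.subset_span (Set.mem_image_of_mem _ hq)
    rw [hV.total_eq_span]
    refine Submodule.span_le.2 ?_
    rintro _ ⟨p, hp, rfl⟩
    exact hWg p.1 (hVW p.1 hp)
  exact hV.fgFamily_of_fg_total (isNoetherian_submodule.1 hGn _ hle)

end Families

section EventuallyPolynomial

/-- A function on pairs of natural numbers given by a polynomial in two variables. -/
def IsPolyFun (f : ℕ × ℕ → ℚ) : Prop :=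
  ∃ p : MvPolynomial (Fin 2) ℚ, ∀ δ, f δ = MvPolynomial.eval ![(δ.1 : ℚ), (δ.2 : ℚ)] p

/-- A function agreeing with a polynomial when both arguments are large. -/
def IsEventuallyPoly (h : ℕ × ℕ → ℚ) : Prop :=
  ∃ f, IsPolyFun f ∧ ∃ N, ∀ δ : ℕ × ℕ, N ≤ δ.1 → N ≤ δ.2 → h δ = f δ

lemma isPolyFun_const (c : ℚ) : IsPolyFun fun _ => c := ⟨MvPolynomial.C c, by simp⟩

lemma isPolyFun_fst : IsPolyFun fun δ => (δ.1 : ℚ) := ⟨MvPolynomial.X 0, by simp⟩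

lemma isPolyFun_snd : IsPolyFun fun δ => (δ.2 : ℚ) := ⟨MvPolynomial.X 1, by simp⟩

lemma IsPolyFun.add {f g : ℕ × ℕ → ℚ} (hf : IsPolyFun f) (hg : IsPolyFun g) :
    IsPolyFun fun δ => f δ + g δ := by
  obtain ⟨p, hp⟩ := hf
  obtain ⟨q, hq⟩ := hg
  exact ⟨p + q, fun δ => by simp [hp, hq]⟩

lemma IsPolyFun.mul {f g : ℕ × ℕ → ℚ} (hf : IsPolyFun f) (hg : IsPolyFun g) :
    IsPolyFun fun δ => f δ * g δ := by
  obtain ⟨p, hp⟩ := hf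
  obtain ⟨q, hq⟩ := hg
  exact ⟨p * q, fun δ => by simp [hp, hq]⟩

lemma IsPolyFun.sub {f g : ℕ × ℕ → ℚ} (hf : IsPolyFun f) (hg : IsPolyFun g) :
    IsPolyFun fun δ => f δ - g δ := by
  obtain ⟨p, hp⟩ := hf
  obtain ⟨q, hq⟩ := hg
  exact ⟨p - q, fun δ => by simp [hp, hq]⟩

lemma IsPolyFun.comp {f : ℕ × ℕ → ℚ} (hf : IsPolyFun f) {u : ℕ × ℕ → ℕ × ℕ}
    (h1 : IsPolyFun fun δ => ((u δ).1 : ℚ)) (h2 : IsPolyFun fun δ => ((u δ).2 : ℚ)) :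
    IsPolyFun fun δ => f (u δ) := by
  obtain ⟨p, hp⟩ := hf
  obtain ⟨q₁, hq₁⟩ := h1
  obtain ⟨q₂, hq₂⟩ := h2
  refine ⟨MvPolynomial.bind₁ ![q₁, q₂] p, fun δ => ?_⟩
  change f (u δ) = _
  rw [hp]
  simp only [MvPolynomial.eval, MvPolynomial.eval₂Hom_bind₁]
  congr 2
  funext i
  fin_cases i
  · exact hq₁ δ
  · exact hq₂ δ

lemma isPolyFun_univ (q : Polynomial ℚ) : IsPolyFun fun δ => q.eval (δ.1 : ℚ) := by
  induction q using Polynomial.induction_on' with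
  | add p q hp hq => simpa using hp.add hq
  | monomial n a =>
    refine ⟨MvPolynomial.C a * MvPolynomial.X 0 ^ n, fun δ => by simp⟩

lemma IsPolyFun.sum_range_fst {f : ℕ × ℕ → ℚ} (hf : IsPolyFun f) :
    IsPolyFun fun δ => ∑ k ∈ Finset.range δ.1, f (k, δ.2) := by
  obtain ⟨p, hp⟩ := hf
  simp only [hp]
  clear hp
  induction p using MvPolynomial.induction_on' with
  | monomial u a =>
    have h1 : IsPolyFun fun δ => ∑ k ∈ Finset.range δ.1, (k : ℚ) ^ u 0 := by
      convert isPolyFun_univ (Polynomial.C (1 / (u 0 + 1 : ℚ)) *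
        (Polynomial.bernoulli (u 0).succ - Polynomial.C (bernoulli (u 0).succ))) using 2 with δ
      have h := Polynomial.sum_range_pow_eq_bernoulli_sub δ.1 (u 0)
      have h' : (u 0 + 1 : ℚ) ≠ 0 := by positivity
      rw [Polynomial.eval_mul, Polynomial.eval_C, Polynomial.eval_sub, Polynomial.eval_C, ← h]
      field_simp
    have h2 : IsPolyFun fun δ => a * (δ.2 : ℚ) ^ u 1 :=
      ⟨MvPolynomial.C a * MvPolynomial.X 1 ^ u 1, fun δ => by simp⟩
    convert h1.mul h2 using 2 with δ
    rw [Finset.sum_mul]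
    refine Finset.sum_congr rfl fun k _ => ?_
    rw [MvPolynomial.eval_monomial, Finsupp.prod_fintype _ _ (by simp)]
    simp only [Fin.prod_univ_two, Matrix.cons_val_zero, Matrix.cons_val_one]
    ring
  | add p q hp hq => simpa [Finset.sum_add_distrib] using hp.add hq

lemma IsEventuallyPoly.add {f g : ℕ × ℕ → ℚ} (hf : IsEventuallyPoly f)
    (hg : IsEventuallyPoly g) : IsEventuallyPoly fun δ => f δ + g δ := by
  obtain ⟨p, hp, N, hN⟩ := hf
  obtain ⟨q, hq, N', hN'⟩ := hg
  refine ⟨_, hp.add hq, max N N', fun δ h1 h2 => ?_⟩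
  simp only [hN δ (by omega) (by omega), hN' δ (by omega) (by omega)]

lemma IsEventuallyPoly.sub {f g : ℕ × ℕ → ℚ} (hf : IsEventuallyPoly f)
    (hg : IsEventuallyPoly g) : IsEventuallyPoly fun δ => f δ - g δ := by
  obtain ⟨p, hp, N, hN⟩ := hf
  obtain ⟨q, hq, N', hN'⟩ := hg
  refine ⟨_, hp.sub hq, max N N', fun δ h1 h2 => ?_⟩
  simp only [hN δ (by omega) (by omega), hN' δ (by omega) (by omega)]

lemma IsEventuallyPoly.shift {f : ℕ × ℕ → ℚ} (hf : IsEventuallyPoly f) (ε : ℕ × ℕ) :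
    IsEventuallyPoly fun δ => f (δ + ε) := by
  obtain ⟨p, hp, N, hN⟩ := hf
  refine ⟨fun δ => p (δ + ε), hp.comp ?_ ?_, N, fun δ h1 h2 => hN _ ?_ ?_⟩
  · simpa using isPolyFun_fst.add (isPolyFun_const ε.1)
  · simpa using isPolyFun_snd.add (isPolyFun_const ε.2)
  · simp only [Prod.fst_add]; omega
  · simp only [Prod.snd_add]; omega

lemma IsEventuallyPoly.congr {f g : ℕ × ℕ → ℚ} (hf : IsEventuallyPoly f) (N : ℕ)
    (h : ∀ δ : ℕ × ℕ, N ≤ δ.1 → N ≤ δ.2 → g δ = f δ) : IsEventuallyPoly g := by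
  obtain ⟨p, hp, N', hN⟩ := hf
  refine ⟨p, hp, max N N', fun δ h1 h2 => ?_⟩
  rw [h δ (by omega) (by omega), hN δ (by omega) (by omega)]

/-- A function of two variables whose two partial differences are eventually polynomial is
eventually polynomial. -/
lemma isEventuallyPoly_of_sub {h : ℕ × ℕ → ℚ}
    (h1 : IsEventuallyPoly fun δ => h (δ + (1, 0)) - h δ)
    (h2 : IsEventuallyPoly fun δ => h (δ + (0, 1)) - h δ) : IsEventuallyPoly h := by
  obtain ⟨f₁, hf₁, N₁, hN₁⟩ := h1
  obtain ⟨f₂, hf₂, N₂, hN₂⟩ := h2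
  obtain ⟨N, hN⟩ : ∃ N, N = max N₁ N₂ := ⟨_, rfl⟩
  have hs := hf₁.sum_range_fst
  have ht := (hf₂.comp (u := Prod.swap) isPolyFun_snd isPolyFun_fst).sum_range_fst
  refine ⟨fun δ => h (N, N) +
      (∑ k ∈ Finset.range δ.2, f₂ (N, k) - ∑ k ∈ Finset.range N, f₂ (N, k)) +
      (∑ k ∈ Finset.range δ.1, f₁ (k, δ.2) - ∑ k ∈ Finset.range N, f₁ (k, δ.2)), ?_, N, ?_⟩
  · refine ((isPolyFun_const _).add (IsPolyFun.sub ?_ (isPolyFun_const _))).add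
      (hs.sub (hs.comp (u := fun δ => (N, δ.2)) (isPolyFun_const (N : ℚ)) isPolyFun_snd))
    exact ht.comp (u := fun δ => (δ.2, N)) isPolyFun_snd (isPolyFun_const (N : ℚ))
  · have key : ∀ b, N ≤ b → h (N, b) = h (N, N) +
        (∑ k ∈ Finset.range b, f₂ (N, k) - ∑ k ∈ Finset.range N, f₂ (N, k)) := by
      intro b hb
      induction b, hb using Nat.le_induction with
      | base => simp
      | succ b hb ih =>
        have := hN₂ (N, b) (by simp; omega) (by simp; omega)
        simp only [Prod.mk_add_mk, add_zero] at this
        rw [Finset.sum_range_succ]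
        linarith
    rintro ⟨a, b⟩ ha hb
    simp only at ha hb ⊢
    rw [← key b hb]
    induction a, ha using Nat.le_induction with
    | base => simp
    | succ a ha ih =>
      have := hN₁ (a, b) (by simp; omega) (by simp; omega)
      simp only [Prod.mk_add_mk, add_zero] at this
      rw [Finset.sum_range_succ]
      linarith

end EventuallyPolynomial

section RelativeLength

variable {R E E' : Type*} [CommRing R] [AddCommGroup E] [Module R E] [AddCommGroup E'] [Module R E']

/-- The length of `Q / (P ∩ Q)`. -/
noncomputable def relLength (P Q : Submodule R E) : ℕ∞ :=
  Module.length R (Q ⧸ P.submoduleOf Q)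

lemma relLength_eq_of_surjective {P Q : Submodule R E} (f : Q →ₗ[R] E')
    (hf : Function.Surjective f) (hk : ∀ z, f z = 0 ↔ (z : E) ∈ P) :
    relLength P Q = Module.length R E' := by
  have h : P.submoduleOf Q = LinearMap.ker f := by
    ext z
    rw [LinearMap.mem_ker, hk]
    rfl
  rw [relLength, h]
  exact (f.quotKerEquivOfSurjective hf).length_eq

lemma relLength_eq_of_map {P Q : Submodule R E} {P' Q' : Submodule R E'} (f : E →ₗ[R] E')
    (hf : Q' = Q.map f ⊔ P') (hk : ∀ z ∈ Q, f z ∈ P' ↔ z ∈ P) :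
    relLength P Q = relLength P' Q' := by
  have hm : ∀ z : Q, f z ∈ Q' := fun z => hf ▸ Submodule.mem_sup_left ⟨z, z.2, rfl⟩
  refine relLength_eq_of_surjective
    ((P'.submoduleOf Q').mkQ ∘ₗ (f ∘ₗ Q.subtype).codRestrict Q' hm) ?_ ?_
  · intro y
    obtain ⟨⟨y, hy⟩, rfl⟩ := Submodule.mkQ_surjective _ y
    obtain ⟨_, ⟨z, hz, rfl⟩, p, hp, rfl⟩ := Submodule.mem_sup.1 (hf ▸ hy)
    refine ⟨⟨z, hz⟩, ?_⟩
    rw [LinearMap.comp_apply, Submodule.mkQ_apply, Submodule.mkQ_apply, Submodule.Quotient.eq]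
    change f z - (f z + p) ∈ P'
    simpa using P'.neg_mem hp
  · intro z
    rw [LinearMap.comp_apply, Submodule.mkQ_apply, Submodule.Quotient.mk_eq_zero]
    exact hk z z.2

lemma relLength_eq_zero {P Q : Submodule R E} (h : Q ≤ P) : relLength P Q = 0 := by
  rw [relLength, Module.length_eq_zero_iff, Submodule.Quotient.subsingleton_iff,
    Submodule.submoduleOf_eq_top]
  exact h

lemma relLength_add {P K Q : Submodule R E} (hPK : P ≤ K) (hKQ : K ≤ Q) :
    relLength P Q = relLength P K + relLength K Q := by
  let f : (K ⧸ P.submoduleOf K) →ₗ[R] Q ⧸ P.submoduleOf Q :=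
    (P.submoduleOf K).mapQ (P.submoduleOf Q) (Submodule.inclusion hKQ) fun z hz => hz
  let g : (Q ⧸ P.submoduleOf Q) →ₗ[R] Q ⧸ K.submoduleOf Q :=
    (P.submoduleOf Q).mapQ (K.submoduleOf Q) LinearMap.id fun z hz => hPK hz
  have hf : ∀ z, f (Submodule.Quotient.mk z) = Submodule.Quotient.mk (Submodule.inclusion hKQ z) :=
    fun _ => rfl
  have hg : ∀ z, g (Submodule.Quotient.mk z) = Submodule.Quotient.mk z := fun _ => rfl
  refine Module.length_eq_add_of_exact f g ?_ ?_ ?_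
  · rw [injective_iff_map_eq_zero]
    intro z hz
    obtain ⟨z, rfl⟩ := Submodule.Quotient.mk_surjective _ z
    rw [hf, Submodule.Quotient.mk_eq_zero] at hz
    exact (Submodule.Quotient.mk_eq_zero _).2 hz
  · intro z
    obtain ⟨z, rfl⟩ := Submodule.Quotient.mk_surjective _ z
    exact ⟨Submodule.Quotient.mk z, rfl⟩
  · intro z
    obtain ⟨z, rfl⟩ := Submodule.Quotient.mk_surjective _ z
    rw [hg, Submodule.Quotient.mk_eq_zero]
    constructor
    · intro hz
      exact ⟨Submodule.Quotient.mk ⟨z, hz⟩, rfl⟩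
    · rintro ⟨y, hy⟩
      obtain ⟨y, rfl⟩ := Submodule.Quotient.mk_surjective _ y
      rw [hf, Submodule.Quotient.eq] at hy
      have h1 : (y : E) - z ∈ K := hPK hy
      have h2 := K.sub_mem y.2 h1
      rwa [sub_sub_cancel] at h2

end RelativeLength

section Hilbert

variable {R E O : Type*} [CommRing R] [AddCommGroup E] [Module R E]

/-- The numerator of the kernel of `op a` acting on the quotient family `Q / P`. -/
def kerFamily (op : O → Module.End R E) (e : O → ℕ × ℕ) (P Q : ℕ × ℕ → Submodule R E) (a : O) :
    ℕ × ℕ → Submodule R E :=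
  fun δ => Q δ ⊓ (P (δ + e a)).comap (op a)

/-- The denominator of the cokernel of `op a` acting on the quotient family `Q / P`. -/
def cokerFamily (op : O → Module.End R E) (e : O → ℕ × ℕ) (P Q : ℕ × ℕ → Submodule R E) (a : O) :
    ℕ × ℕ → Submodule R E :=
  fun δ => P δ ⊔ ⨆ δ', ⨆ _ : δ' + e a = δ, (Q δ').map (op a)

variable {op : O → Module.End R E} {e : O → ℕ × ℕ} {P Q : ℕ × ℕ → Submodule R E}

lemma cokerFamily_add (a : O) (δ : ℕ × ℕ) :
    cokerFamily op e P Q a (δ + e a) = P (δ + e a) ⊔ (Q δ).map (op a) := by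
  simp [cokerFamily]

lemma cokerFamily_le (hQ : IsStableFamily op e Q) (hPQ : P ≤ Q) (a : O) :
    cokerFamily op e P Q a ≤ Q := by
  intro δ
  refine sup_le (hPQ δ) (iSup_le fun δ' => iSup_le fun h => ?_)
  rintro _ ⟨z, hz, rfl⟩
  exact h ▸ hQ a δ' z hz

lemma isStableFamily_kerFamily (comm : ∀ o o', Commute (op o) (op o'))
    (hP : IsStableFamily op e P) (hQ : IsStableFamily op e Q) (a : O) :
    IsStableFamily op e (kerFamily op e P Q a) := by
  intro o δ z hz
  refine ⟨hQ o δ z hz.1, ?_⟩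
  have h : op a (op o z) = op o (op a z) := LinearMap.congr_fun (comm a o) z
  change op a (op o z) ∈ P (δ + e o + e a)
  rw [h, add_right_comm]
  exact hP o _ _ hz.2

lemma isStableFamily_cokerFamily (comm : ∀ o o', Commute (op o) (op o'))
    (hP : IsStableFamily op e P) (hQ : IsStableFamily op e Q) (a : O) :
    IsStableFamily op e (cokerFamily op e P Q a) := by
  intro o δ
  change cokerFamily op e P Q a δ ≤ (cokerFamily op e P Q a (δ + e o)).comap (op o)
  refine sup_le (fun z hz => Submodule.mem_sup_left (hP o δ z hz))
    (iSup_le fun δ' => iSup_le fun h => ?_)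
  rintro _ ⟨z, hz, rfl⟩
  have h' : op o (op a z) = op a (op o z) := LinearMap.congr_fun (comm o a) z
  rw [Submodule.mem_comap, h', ← h, add_right_comm, cokerFamily_add]
  exact Submodule.mem_sup_right ⟨_, hQ o _ _ hz, rfl⟩

lemma relLength_ker_coker (hQ : IsStableFamily op e Q) (hP : IsStableFamily op e P) (hPQ : P ≤ Q)
    (a : O) (δ : ℕ × ℕ) :
    relLength (P δ) (Q δ) + relLength (cokerFamily op e P Q a (δ + e a)) (Q (δ + e a)) =
      relLength (P δ) (kerFamily op e P Q a δ) + relLength (P (δ + e a)) (Q (δ + e a)) := by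
  have h1 : P δ ≤ kerFamily op e P Q a δ := fun z hz => ⟨hPQ δ hz, hP a δ z hz⟩
  have h2 : kerFamily op e P Q a δ ≤ Q δ := fun z hz => hz.1
  have h3 : P (δ + e a) ≤ cokerFamily op e P Q a (δ + e a) := le_sup_left
  rw [relLength_add h1 h2, relLength_add h3 (cokerFamily_le hQ hPQ a _), add_assoc]
  congr 2
  refine relLength_eq_of_map (op a) (by rw [cokerFamily_add, sup_comm]) fun z hz => ?_
  exact ⟨fun h => ⟨hz, h⟩, fun h => h.2⟩

/-- If every operator raising the degree `π` acts as zero on a finitely generated quotient family,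
then the family vanishes in large degrees. -/
lemma exists_le_of_kills (hQ : IsStableFamily op e Q) (hP : IsStableFamily op e P) (hPQ : P ≤ Q)
    (hfg : FGFamily op e Q) (π : ℕ × ℕ →+ ℕ)
    (h : ∀ o, π (e o) = 0 ∨ ∀ δ, ∀ z ∈ Q δ, op o z ∈ P (δ + e o)) :
    ∃ N, ∀ δ, N ≤ π δ → Q δ ≤ P δ := by
  obtain ⟨s, hs, hgen⟩ := hfg
  refine ⟨s.sup (fun p => π p.1) + 1, fun δ hδ => ?_⟩
  set N := s.sup (fun p => π p.1) + 1 with hN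
  let V : ℕ × ℕ → Submodule R E := fun δ => if π δ < N then Q δ else P δ
  have hVQ : V ≤ Q := fun δ => by
    dsimp only [V]
    split_ifs
    exacts [le_rfl, hPQ δ]
  have hPV : P ≤ V := fun δ => by
    dsimp only [V]
    split_ifs
    exacts [hPQ δ, le_rfl]
  have hV : Q ≤ V := by
    refine hgen V (fun o δ z hz => ?_) fun p hp => ?_
    · rcases h o with h0 | h0
      · dsimp only [V] at hz ⊢
        rw [map_add, h0, add_zero]
        split_ifs at hz ⊢
        exacts [hQ o δ z hz, hP o δ z hz]
      · exact hPV _ (h0 δ z (hVQ δ hz))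
    · have : π p.1 < N := Nat.lt_succ_of_le (Finset.le_sup (f := fun p => π p.1) hp)
      simp only [V, if_pos this]
      exact hs p hp
  have := hV δ
  simpa only [V, if_neg (not_lt.2 hδ)] using this

open scoped Classical in
/-- The operators acting non-trivially on the quotient family `Q / P`. -/
noncomputable def activeOps [Fintype O] (op : O → Module.End R E) (e : O → ℕ × ℕ)
    (P Q : ℕ × ℕ → Submodule R E) : Finset O :=
  {o | ¬ ∀ δ, ∀ z ∈ Q δ, op o z ∈ P (δ + e o)}

lemma mem_activeOps [Fintype O] {o : O} :
    o ∈ activeOps op e P Q ↔ ¬ ∀ δ, ∀ z ∈ Q δ, op o z ∈ P (δ + e o) := by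
  simp [activeOps]

lemma activeOps_kerFamily_ssubset [Fintype O] {a : O} (ha : a ∈ activeOps op e P Q) :
    activeOps op e P (kerFamily op e P Q a) ⊂ activeOps op e P Q := by
  refine Finset.ssubset_iff_of_subset (fun o ho => ?_) |>.2 ⟨a, ha, fun h => ?_⟩
  · rw [mem_activeOps] at ho ⊢
    exact fun h => ho fun δ z hz => h δ z hz.1
  · exact mem_activeOps.1 h fun δ z hz => hz.2

lemma activeOps_cokerFamily_ssubset [Fintype O] {a : O} (ha : a ∈ activeOps op e P Q) :
    activeOps op e (cokerFamily op e P Q a) Q ⊂ activeOps op e P Q := by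
  refine Finset.ssubset_iff_of_subset (fun o ho => ?_) |>.2 ⟨a, ha, fun h => ?_⟩
  · rw [mem_activeOps] at ho ⊢
    exact fun h => ho fun δ z hz => Submodule.mem_sup_left (h δ z hz)
  · refine mem_activeOps.1 h fun δ z hz => ?_
    rw [cokerFamily_add]
    exact Submodule.mem_sup_right ⟨z, hz, rfl⟩

/-- The Hilbert function of a finitely generated bigraded quotient family, all of whose components
of large degree have finite length, is eventually polynomial. -/
theorem isEventuallyPoly_relLength [IsNoetherianRing R] [Fintype O]
    (comm : ∀ o o', Commute (op o) (op o')) (he : ∀ o, e o = (1, 0) ∨ e o = (0, 1))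
    (P Q : ℕ × ℕ → Submodule R E)
    (hP : IsStableFamily op e P) (hQ : IsStableFamily op e Q) (hPQ : P ≤ Q)
    (hfg : FGFamily op e Q)
    (hfin : ∃ N, ∀ δ : ℕ × ℕ, N ≤ δ.1 → N ≤ δ.2 → relLength (P δ) (Q δ) ≠ ⊤) :
    IsEventuallyPoly fun δ => ((relLength (P δ) (Q δ)).toNat : ℚ) := by
  induction hs : activeOps op e P Q using Finset.strongInduction generalizing P Q with
  | H s ih =>
  obtain ⟨N, hN⟩ := hfin
  have zero : ∀ N', (∀ δ : ℕ × ℕ, N' ≤ δ.1 → N' ≤ δ.2 → Q δ ≤ P δ) →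
      IsEventuallyPoly fun δ => ((relLength (P δ) (Q δ)).toNat : ℚ) := fun N' h =>
    ⟨_, isPolyFun_const 0, N', fun δ h1 h2 => by simp [relLength_eq_zero (h δ h1 h2)]⟩
  have step : ∀ a ∈ s, IsEventuallyPoly fun δ =>
      ((relLength (P (δ + e a)) (Q (δ + e a))).toNat : ℚ) - ((relLength (P δ) (Q δ)).toNat : ℚ) := by
    intro a ha
    rw [← hs] at ha
    have hKQ : kerFamily op e P Q a ≤ Q := fun δ z hz => hz.1
    have hPK : P ≤ kerFamily op e P Q a := fun δ z hz => ⟨hPQ δ hz, hP a δ z hz⟩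
    have hPC : P ≤ cokerFamily op e P Q a := fun δ => le_sup_left
    have hCQ := cokerFamily_le hQ hPQ a
    have hK := isStableFamily_kerFamily comm hP hQ a
    have hC := isStableFamily_cokerFamily comm hP hQ a
    have finK : ∀ δ : ℕ × ℕ, N ≤ δ.1 → N ≤ δ.2 →
        relLength (P δ) (kerFamily op e P Q a δ) ≠ ⊤ := fun δ h1 h2 h => by
      apply hN δ h1 h2
      rw [relLength_add (hPK δ) (hKQ δ), h, top_add]
    have finC : ∀ δ : ℕ × ℕ, N ≤ δ.1 → N ≤ δ.2 →
        relLength (cokerFamily op e P Q a δ) (Q δ) ≠ ⊤ := fun δ h1 h2 h => by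
      apply hN δ h1 h2
      rw [relLength_add (hPC δ) (hCQ δ), h, add_top]
    have ihK := ih _ (hs ▸ activeOps_kerFamily_ssubset ha) P _ hP hK hPK
      (hfg.of_le comm hK hKQ) ⟨N, finK⟩ rfl
    have ihC := ih _ (hs ▸ activeOps_cokerFamily_ssubset ha) _ Q hC hQ hCQ hfg ⟨N, finC⟩ rfl
    refine ((ihC.shift (e a)).sub ihK).congr N fun δ h1 h2 => ?_
    have h1' : N ≤ (δ + e a).1 := by simp only [Prod.fst_add]; omega
    have h2' : N ≤ (δ + e a).2 := by simp only [Prod.snd_add]; omega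
    have h := congrArg ENat.toNat (relLength_ker_coker hQ hP hPQ a δ)
    rw [ENat.toNat_add (hN δ h1 h2) (finC _ h1' h2'),
      ENat.toNat_add (finK δ h1 h2) (hN _ h1' h2')] at h
    have h' := congrArg (Nat.cast (R := ℚ)) h
    push_cast at h'
    linarith
  by_cases h1 : ∃ a ∈ s, e a = (1, 0)
  · by_cases h2 : ∃ b ∈ s, e b = (0, 1)
    · obtain ⟨a, ha, hea⟩ := h1
      obtain ⟨b, hb, heb⟩ := h2
      exact isEventuallyPoly_of_sub (hea ▸ step a ha) (heb ▸ step b hb)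
    · obtain ⟨N', hN'⟩ := exists_le_of_kills hQ hP hPQ hfg (AddMonoidHom.snd ℕ ℕ) fun o => by
        by_cases ho : o ∈ s
        · rcases he o with h | h
          · exact Or.inl (by simp [h])
          · exact absurd ⟨o, ho, h⟩ h2
        · exact Or.inr (by rwa [← hs, mem_activeOps, not_not] at ho)
      exact zero N' fun δ _ h => hN' δ h
  · obtain ⟨N', hN'⟩ := exists_le_of_kills hQ hP hPQ hfg (AddMonoidHom.fst ℕ ℕ) fun o => by
      by_cases ho : o ∈ s
      · rcases he o with h | h
        · exact absurd ⟨o, ho, h⟩ h1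
        · exact Or.inl (by simp [h])
      · exact Or.inr (by rwa [← hs, mem_activeOps, not_not] at ho)
    exact zero N' fun δ h _ => hN' δ h

end Hilbert

section GradedResolution

variable {R τ : Type} [CommRing R]

/-- The free module on pairs of a generator (a natural number) and a monomial in `τ`. -/
abbrev MonoFree (R τ : Type) [CommRing R] : Type := (ℕ × Multiset τ) →₀ R

/-- Multiplication by a monomial. -/
noncomputable def monoShift (R : Type) {τ : Type} [CommRing R] (a : Multiset τ) :
    Module.End R (MonoFree R τ) :=
  Finsupp.lmapDomain R R fun p => (p.1, a + p.2)

lemma monoShift_single (a b : Multiset τ) (k : ℕ) (r : R) :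
    monoShift R a (Finsupp.single (k, b) r) = Finsupp.single (k, a + b) r := by
  simp [monoShift, Finsupp.mapDomain_single]

/-- The number of generators of a graded free module, and their degrees. -/
structure FreeShape where
  /-- the number of generators -/
  rank : ℕ
  /-- the degrees of the generators -/
  deg : ℕ → ℕ

/-- The indices of the monomial basis in degree `m`. -/
def FreeShape.index (τ : Type) (s : FreeShape) (m : ℕ) : Set (ℕ × Multiset τ) :=
  {p | p.1 < s.rank ∧ s.deg p.1 + p.2.card = m}

/-- The homogeneous component of degree `m` of the graded free module of shape `s`. -/
noncomputable def FreeShape.piece (R τ : Type) [CommRing R] (s : FreeShape) (m : ℕ) :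
    Submodule R (MonoFree R τ) :=
  Finsupp.supported R R (s.index τ m)

lemma FreeShape.piece_eq_span (s : FreeShape) (m : ℕ) :
    s.piece R τ m = Submodule.span R ((fun p => Finsupp.single p 1) '' s.index τ m) :=
  Finsupp.supported_eq_span_single R _

instance (s : FreeShape) (m : ℕ) : Module.Free R (s.piece R τ m) :=
  Module.Free.of_equiv (Finsupp.supportedEquivFinsupp (M := R) (R := R) (s.index τ m)).symm

/-- The operators multiplying by a single variable. -/
noncomputable abbrev varShift (R : Type) {τ : Type} [CommRing R] (b : τ) :
    Module.End R (MonoFree R τ) :=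
  monoShift R {b}

lemma varShift_commute (b b' : τ) : Commute (varShift R b) (varShift R b') := by
  refine Finsupp.lhom_ext fun p r => ?_
  obtain ⟨k, a⟩ := p
  rw [Module.End.mul_apply, Module.End.mul_apply, monoShift_single, monoShift_single,
    monoShift_single, monoShift_single, add_left_comm]

lemma FreeShape.isStableFamily_piece (s : FreeShape) :
    IsStableFamily (varShift R) (fun _ : τ => 1) (s.piece R τ) := by
  intro b m
  change s.piece R τ m ≤ (s.piece R τ (m + 1)).comap (varShift R b)
  rw [s.piece_eq_span m, Submodule.span_le]
  rintro _ ⟨⟨k, a⟩, ⟨hk, hm⟩, rfl⟩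
  simp only [SetLike.mem_coe, Submodule.mem_comap, monoShift_single]
  refine Finsupp.single_mem_supported R _ ⟨hk, ?_⟩
  simp only [Multiset.singleton_add, Multiset.card_cons] at hm ⊢
  omega

lemma FreeShape.fgFamily_piece (s : FreeShape) :
    FGFamily (varShift R) (fun _ : τ => 1) (s.piece R τ) := by
  classical
  refine ⟨(Finset.range s.rank).image fun k => (s.deg k, Finsupp.single (k, 0) 1), ?_, ?_⟩
  · intro p hp
    obtain ⟨k, hk, rfl⟩ := Finset.mem_image.1 hp
    exact Finsupp.single_mem_supported R _ ⟨Finset.mem_range.1 hk, by simp⟩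
  · intro V hV hgen m
    rw [s.piece_eq_span m, Submodule.span_le]
    rintro _ ⟨⟨k, a⟩, ⟨hk, hm⟩, rfl⟩
    induction a using Multiset.induction generalizing m with
    | empty =>
      have := hgen _ (Finset.mem_image_of_mem _ (Finset.mem_range.2 hk))
      simp only [Multiset.card_zero, add_zero] at hm
      subst hm
      exact this
    | cons b a ih =>
      have := hV b _ _ (ih (s.deg k + a.card) hk rfl)
      simp only [Multiset.card_cons] at hm
      simp only [monoShift_single, Multiset.singleton_add, add_assoc, hm] at this
      exact this

variable {E : Type} [AddCommGroup E] [Module R E]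

/-- The map from the free module determined by the images of the generators. -/
noncomputable def monoLift (op : Multiset τ → Module.End R E) (g : ℕ → E) :
    MonoFree R τ →ₗ[R] E :=
  Finsupp.linearCombination R fun p => op p.2 (g p.1)

lemma monoLift_single (op : Multiset τ → Module.End R E) (g : ℕ → E) (k : ℕ) (a : Multiset τ)
    (r : R) : monoLift op g (Finsupp.single (k, a) r) = r • op a (g k) := by
  simp [monoLift]

lemma monoLift_monoShift {op : Multiset τ → Module.End R E}
    (hadd : ∀ a b, op (a + b) = op a * op b) (g : ℕ → E) (a : Multiset τ) (z : MonoFree R τ) :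
    monoLift op g (monoShift R a z) = op a (monoLift op g z) := by
  suffices h : monoLift op g ∘ₗ monoShift R a = op a ∘ₗ monoLift op g from LinearMap.congr_fun h z
  refine Finsupp.lhom_ext fun p r => ?_
  obtain ⟨k, b⟩ := p
  simp only [LinearMap.comp_apply, monoShift_single, monoLift_single, hadd, Module.End.mul_apply,
    map_smul]

/-- A finitely generated stable family is the image of the components of a graded free module. -/
lemma exists_map_piece_eq {op : Multiset τ → Module.End R E} (hzero : op 0 = 1)
    (hadd : ∀ a b, op (a + b) = op a * op b) {K : ℕ → Submodule R E}
    (hK : IsStableFamily (fun b : τ => op {b}) (fun _ => 1) K)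
    (hfg : FGFamily (fun b : τ => op {b}) (fun _ => 1) K) :
    ∃ (s : FreeShape) (g : ℕ → E), ∀ m, (s.piece R τ m).map (monoLift op g) = K m := by
  obtain ⟨t, ht, hgen⟩ := hfg
  let l := t.toList
  let s : FreeShape := ⟨l.length, fun k => (l.getD k (0, 0)).1⟩
  let g : ℕ → E := fun k => (l.getD k (0, 0)).2
  have hg : ∀ k < l.length, g k ∈ K (s.deg k) := by
    intro k hk
    refine ht (l.getD k (0, 0)) ?_
    rw [List.getD_eq_getElem _ _ hk]
    exact Finset.mem_toList.1 (List.getElem_mem hk)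
  have hmap : ∀ m, (s.piece R τ m).map (monoLift op g) =
      Submodule.span R ((fun p : ℕ × Multiset τ => op p.2 (g p.1)) '' s.index τ m) := fun m =>
    (Finsupp.span_image_eq_map_linearCombination R _).symm
  refine ⟨s, g, fun m => ?_⟩
  rw [hmap]
  refine le_antisymm ?_ ?_
  · rw [Submodule.span_le]
    rintro _ ⟨⟨k, a⟩, ⟨hk, hm⟩, rfl⟩
    induction a using Multiset.induction generalizing m with
    | empty =>
      simp only [Multiset.card_zero, add_zero] at hm
      subst hm
      simpa [hzero] using hg k hk
    | cons b a ih =>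
      have := hK b _ _ (ih (s.deg k + a.card) hk rfl)
      simp only [Multiset.card_cons] at hm
      rw [← Module.End.mul_apply, ← hadd, Multiset.singleton_add, add_assoc, hm] at this
      exact this
  · refine hgen (fun m => Submodule.span R ((fun p : ℕ × Multiset τ => op p.2 (g p.1)) ''
      s.index τ m)) (fun b m => ?_) (fun p hp => ?_) m
    · change Submodule.span R _ ≤ (Submodule.span R _).comap (op {b})
      rw [Submodule.span_le]
      rintro _ ⟨⟨k, a⟩, ⟨hk, hm⟩, rfl⟩
      refine Submodule.subset_span ⟨(k, b ::ₘ a), ⟨hk, ?_⟩, ?_⟩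
      · simp only [Multiset.card_cons] at hm ⊢
        omega
      · rw [← Module.End.mul_apply, ← hadd, Multiset.singleton_add]
    · obtain ⟨k, hk, hp⟩ := List.mem_iff_getElem.1 (Finset.mem_toList.2 hp)
      have hp' : l.getD k (0, 0) = p := by rw [List.getD_eq_getElem _ _ hk]; exact hp
      refine Submodule.subset_span ⟨(k, 0), ⟨hk, ?_⟩, ?_⟩
      · simpa [s] using congrArg Prod.fst hp'
      · simpa [g, hzero] using congrArg Prod.snd hp'

lemma monoShift_zero : monoShift R (0 : Multiset τ) = 1 := by
  refine Finsupp.lhom_ext fun p r => ?_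
  simp [monoShift_single (0 : Multiset τ) p.2 p.1 r]

lemma monoShift_add (a b : Multiset τ) : monoShift R (a + b) = monoShift R a * monoShift R b := by
  refine Finsupp.lhom_ext fun p r => ?_
  obtain ⟨k, c⟩ := p
  simp only [Module.End.mul_apply, monoShift_single, add_assoc]

/-- The kernel family of a map from a graded free module is stable and finitely generated. -/
lemma ker_inf_piece_good [IsNoetherianRing R] [Finite τ] {op : Multiset τ → Module.End R E}
    (hadd : ∀ a b, op (a + b) = op a * op b) (s : FreeShape) (g : ℕ → E) :
    IsStableFamily (varShift R) (fun _ : τ => 1)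
        (fun m => LinearMap.ker (monoLift op g) ⊓ s.piece R τ m) ∧
      FGFamily (varShift R) (fun _ : τ => 1)
        (fun m => LinearMap.ker (monoLift op g) ⊓ s.piece R τ m) := by
  have h : IsStableFamily (varShift R) (fun _ : τ => 1)
      (fun m => LinearMap.ker (monoLift op g) ⊓ s.piece R τ m) := fun b m z hz => by
    refine ⟨?_, s.isStableFamily_piece b m z hz.2⟩
    have hz1 : monoLift op g z = 0 := hz.1
    change monoLift op g (monoShift R {b} z) = 0
    rw [monoLift_monoShift hadd, hz1, map_zero]
  exact ⟨h, s.fgFamily_piece.of_le varShift_commute h fun m => inf_le_right⟩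

/-- A stable finitely generated family in a graded free module has a graded free resolution. -/
lemma exists_resolution_of_family [IsNoetherianRing R] [Finite τ]
    (K : ℕ → Submodule R (MonoFree R τ)) (hK : IsStableFamily (varShift R) (fun _ : τ => 1) K)
    (hfg : FGFamily (varShift R) (fun _ : τ => 1) K) :
    ∃ (s : ℕ → FreeShape) (g : ℕ → ℕ → MonoFree R τ),
      (∀ m, ((s 0).piece R τ m).map (monoLift (monoShift R) (g 0)) = K m) ∧
      ∀ j m, ((s (j + 1)).piece R τ m).map (monoLift (monoShift R) (g (j + 1))) =
        LinearMap.ker (monoLift (monoShift R) (g j)) ⊓ (s j).piece R τ m := by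
  let T := {K : ℕ → Submodule R (MonoFree R τ) //
    IsStableFamily (varShift R) (fun _ : τ => 1) K ∧ FGFamily (varShift R) (fun _ : τ => 1) K}
  have h : ∀ K : T, ∃ (s : FreeShape) (g : ℕ → MonoFree R τ),
      ∀ m, (s.piece R τ m).map (monoLift (monoShift R) g) = K.1 m := fun K =>
    exists_map_piece_eq monoShift_zero monoShift_add K.2.1 K.2.2
  choose s g hsg using h
  let next : T → T := fun K => ⟨_, ker_inf_piece_good monoShift_add (s K) (g K)⟩
  let seq : ℕ → T := fun j => next^[j] ⟨K, hK, hfg⟩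
  refine ⟨fun j => s (seq j), fun j => g (seq j), fun m => hsg _ m, fun j m => ?_⟩
  rw [hsg]
  have : seq (j + 1) = next (seq j) := Function.iterate_succ_apply' _ _ _
  rw [this]

lemma span_range_smul_le {f : τ → R} {W V : Submodule R E}
    (h : ∀ b, ∀ z ∈ W, f b • z ∈ V) : Ideal.span (Set.range f) • W ≤ V := by
  refine Submodule.smul_le.2 fun r hr z hz => ?_
  induction hr using Submodule.span_induction with
  | mem r hr => obtain ⟨b, rfl⟩ := hr; exact h b z hz
  | zero => rw [zero_smul]; exact V.zero_mem
  | add r r' _ _ h1 h2 => rw [add_smul]; exact V.add_mem h1 h2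
  | smul c r _ h1 => rw [smul_assoc]; exact V.smul_mem c h1

/-- The family of submodules `Jᵐ N` has a graded free resolution. -/
theorem exists_graded_resolution [IsNoetherianRing R] [Finite τ] (f : τ → R)
    (N : Type) [AddCommGroup N] [Module R N] [Module.Finite R N] :
    ∃ (s : ℕ → FreeShape) (d : ℕ → Module.End R (MonoFree R τ)) (ε : MonoFree R τ →ₗ[R] N),
      (∀ m, ((s 0).piece R τ m).map ε = Ideal.span (Set.range f) ^ m • (⊤ : Submodule R N)) ∧
      (∀ m, ((s 1).piece R τ m).map (d 1) = LinearMap.ker ε ⊓ (s 0).piece R τ m) ∧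
      (∀ j m, ((s (j + 2)).piece R τ m).map (d (j + 2)) =
        LinearMap.ker (d (j + 1)) ⊓ (s (j + 1)).piece R τ m) ∧
      d 0 = 0 ∧ ∀ j a z, d j (monoShift R a z) = monoShift R a (d j z) := by
  let op : Multiset τ → Module.End R N := fun a => algebraMap R (Module.End R N) (a.map f).prod
  have hzero : op 0 = 1 := by simp [op]
  have hadd : ∀ a b, op (a + b) = op a * op b := fun a b => by simp [op]
  have hop : ∀ b z, op {b} z = f b • z := fun b z => by simp [op]
  let K : ℕ → Submodule R N := fun m => Ideal.span (Set.range f) ^ m • (⊤ : Submodule R N)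
  have hK : IsStableFamily (fun b : τ => op {b}) (fun _ => 1) K := fun b m z hz => by
    simp only [hop, K]
    rw [pow_succ', Submodule.mul_smul]
    exact Submodule.smul_mem_smul (Ideal.subset_span ⟨b, rfl⟩) hz
  have hfg : FGFamily (fun b : τ => op {b}) (fun _ => 1) K := by
    classical
    obtain ⟨t, ht⟩ := Module.Finite.fg_top (R := R) (M := N)
    refine ⟨t.image fun z => (0, z), fun p hp => ?_, fun V hV hgen m => ?_⟩
    · obtain ⟨z, hz, rfl⟩ := Finset.mem_image.1 hp
      simp [K]
    · induction m with
      | zero =>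
        simp only [K, pow_zero, Ideal.one_eq_top, Submodule.top_smul]
        rw [← ht, Submodule.span_le]
        exact fun z hz => hgen _ (Finset.mem_image_of_mem _ hz)
      | succ m ih =>
        simp only [K]
        rw [pow_succ', Submodule.mul_smul]
        exact span_range_smul_le fun b z hz => hop b z ▸ hV b m z (ih hz)
  obtain ⟨s₀, g₀, h₀⟩ := exists_map_piece_eq hzero hadd hK hfg
  obtain ⟨hL, hLfg⟩ := ker_inf_piece_good hadd s₀ g₀
  obtain ⟨s, g, h₁, h₂⟩ := exists_resolution_of_family _ hL hLfg
  refine ⟨fun j => Nat.casesOn j s₀ s, fun j => Nat.casesOn j 0 fun j =>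
    monoLift (monoShift R) (g j), monoLift op g₀, h₀, h₁, h₂, rfl, fun j a z => ?_⟩
  cases j with
  | zero => simp
  | succ j => exact monoLift_monoShift monoShift_add _ a z

end GradedResolution

section TensorFamily

open TensorProduct

variable {R σ τ : Type} [CommRing R] (M : Type) [AddCommGroup M] [Module R M]

/-- The operators on `M ⊗ MonoFree R τ` given by scalars and by variables. -/
noncomputable def tensorOp (c : σ → R) : σ ⊕ τ → Module.End R (M ⊗[R] MonoFree R τ) :=
  Sum.elim (fun a => algebraMap R _ (c a)) fun b => (varShift R b).lTensor M

/-- The bidegrees of the operators. -/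
def tensorDeg : σ ⊕ τ → ℕ × ℕ :=
  Sum.elim (fun _ => (0, 1)) fun _ => (1, 0)

lemma tensorDeg_eq (o : σ ⊕ τ) : tensorDeg o = (1, 0) ∨ tensorDeg o = (0, 1) := by
  cases o <;> simp [tensorDeg]

lemma tensorOp_commute (c : σ → R) (o o' : σ ⊕ τ) :
    Commute (tensorOp M c o) (tensorOp M c o') := by
  rcases o with a | b <;> rcases o' with a' | b'
  · exact Algebra.commutes _ _
  · exact Algebra.commutes _ _
  · exact (Algebra.commutes _ _).symm
  · change _ * _ = _ * _
    simp only [tensorOp, Sum.elim_inr, ← LinearMap.lTensor_mul, (varShift_commute b b').eq]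

/-- The bihomogeneous components of `M ⊗ MonoFree R τ`. -/
noncomputable def tensorPiece (c : σ → R) (s : FreeShape) (δ : ℕ × ℕ) :
    Submodule R (M ⊗[R] MonoFree R τ) :=
  LinearMap.range (TensorProduct.mapIncl
    (Ideal.span (Set.range c) ^ δ.2 • (⊤ : Submodule R M)) (s.piece R τ δ.1))

variable {M}

lemma tmul_mem_tensorPiece {c : σ → R} {s : FreeShape} {δ : ℕ × ℕ} {x : M} {y : MonoFree R τ}
    (hx : x ∈ Ideal.span (Set.range c) ^ δ.2 • (⊤ : Submodule R M)) (hy : y ∈ s.piece R τ δ.1) :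
    x ⊗ₜ y ∈ tensorPiece M c s δ :=
  ⟨⟨x, hx⟩ ⊗ₜ ⟨y, hy⟩, rfl⟩

lemma tensorPiece_le {c : σ → R} {s : FreeShape} {δ : ℕ × ℕ}
    {W : Submodule R (M ⊗[R] MonoFree R τ)}
    (h : ∀ x ∈ Ideal.span (Set.range c) ^ δ.2 • (⊤ : Submodule R M), ∀ y ∈ s.piece R τ δ.1,
      x ⊗ₜ y ∈ W) : tensorPiece M c s δ ≤ W := by
  rintro _ ⟨z, rfl⟩
  induction z with
  | zero => rw [map_zero]; exact W.zero_mem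
  | tmul x y => exact h x x.2 y y.2
  | add z z' h1 h2 => rw [map_add]; exact W.add_mem h1 h2

lemma isStableFamily_tensorPiece (c : σ → R) (s : FreeShape) :
    IsStableFamily (tensorOp M c) tensorDeg (tensorPiece (τ := τ) M c s) := by
  intro o δ
  change tensorPiece M c s δ ≤ (tensorPiece M c s (δ + tensorDeg o)).comap (tensorOp M c o)
  refine tensorPiece_le fun x hx y hy => ?_
  rw [Submodule.mem_comap]
  rcases o with a | b
  · change c a • (x ⊗ₜ y) ∈ _
    rw [TensorProduct.smul_tmul']
    refine tmul_mem_tensorPiece ?_ hy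
    change _ ∈ Ideal.span (Set.range c) ^ (δ.2 + 1) • (⊤ : Submodule R M)
    rw [pow_succ', Submodule.mul_smul]
    exact Submodule.smul_mem_smul (Ideal.subset_span ⟨a, rfl⟩) hx
  · exact tmul_mem_tensorPiece hx (s.isStableFamily_piece b _ _ hy)

lemma fgFamily_tensorPiece [Module.Finite R M] (c : σ → R) (s : FreeShape) :
    FGFamily (tensorOp M c) tensorDeg (tensorPiece (τ := τ) M c s) := by
  classical
  obtain ⟨t, ht⟩ := Module.Finite.fg_top (R := R) (M := M)
  refine ⟨(t ×ˢ Finset.range s.rank).image fun q =>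
    ((s.deg q.2, 0), q.1 ⊗ₜ Finsupp.single (q.2, 0) 1), fun p hp => ?_, fun V hV hgen δ => ?_⟩
  · obtain ⟨⟨x, k⟩, hq, rfl⟩ := Finset.mem_image.1 hp
    rw [Finset.mem_product, Finset.mem_range] at hq
    exact tmul_mem_tensorPiece (by simp) (Finsupp.single_mem_supported R _ ⟨hq.2, by simp⟩)
  · obtain ⟨m, n⟩ := δ
    have key : ∀ n, ∀ x ∈ Ideal.span (Set.range c) ^ n • (⊤ : Submodule R M),
        ∀ k < s.rank, x ⊗ₜ Finsupp.single (k, 0) 1 ∈ V (s.deg k, n) := by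
      intro n
      induction n with
      | zero =>
        intro x _ k hk
        have hx : x ∈ Submodule.span R (t : Set M) := ht ▸ Submodule.mem_top
        suffices h : Submodule.span R (t : Set M) ≤
            (V (s.deg k, 0)).comap ((TensorProduct.mk R M (MonoFree R τ)).flip
              (Finsupp.single (k, 0) 1)) from h hx
        rw [Submodule.span_le]
        intro x hx
        exact hgen _ (Finset.mem_image_of_mem (fun q : M × ℕ => ((s.deg q.2, 0),
          q.1 ⊗ₜ[R] Finsupp.single (q.2, (0 : Multiset τ)) (1 : R)))
          (Finset.mem_product.2 ⟨hx, Finset.mem_range.2 hk⟩ : (x, k) ∈ _))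
      | succ n ih =>
        intro x hx k hk
        rw [pow_succ', Submodule.mul_smul] at hx
        suffices h : Ideal.span (Set.range c) • Ideal.span (Set.range c) ^ n • (⊤ : Submodule R M) ≤
            (V (s.deg k, n + 1)).comap ((TensorProduct.mk R M (MonoFree R τ)).flip
              (Finsupp.single (k, 0) 1)) from h hx
        refine span_range_smul_le fun a x hx => ?_
        exact hV (Sum.inl a) _ _ (ih x hx k hk)
    have key2 : ∀ x ∈ Ideal.span (Set.range c) ^ n • (⊤ : Submodule R M), ∀ k < s.rank,
        ∀ a : Multiset τ, x ⊗ₜ Finsupp.single (k, a) 1 ∈ V (s.deg k + a.card, n) := by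
      intro x hx k hk a
      induction a using Multiset.induction with
      | empty => exact key n x hx k hk
      | cons b a ih =>
        have := hV (Sum.inr b) _ _ ih
        simpa [tensorOp, tensorDeg, monoShift_single, add_assoc] using this
    refine tensorPiece_le fun x hx y hy => ?_
    suffices h : s.piece R τ m ≤ (V (m, n)).comap (TensorProduct.mk R M (MonoFree R τ) x) from h hy
    rw [s.piece_eq_span m, Submodule.span_le]
    rintro _ ⟨⟨k, a⟩, ⟨hk, hm⟩, rfl⟩
    have := key2 x hx k hk a
    simp only at hm
    rwa [hm] at this

/-- The cycles of the bigraded tensor product complex. -/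
noncomputable def tensorCycles (c : σ → R) (s : FreeShape) (d : Module.End R (MonoFree R τ))
    (δ : ℕ × ℕ) : Submodule R (M ⊗[R] MonoFree R τ) :=
  LinearMap.ker (d.lTensor M) ⊓ tensorPiece M c s δ

/-- The boundaries of the bigraded tensor product complex. -/
noncomputable def tensorBoundaries (c : σ → R) (s : FreeShape) (d : Module.End R (MonoFree R τ))
    (δ : ℕ × ℕ) : Submodule R (M ⊗[R] MonoFree R τ) :=
  (tensorPiece M c s δ).map (d.lTensor M)

lemma tensorOp_lTensor (c : σ → R) {d : Module.End R (MonoFree R τ)}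
    (hd : ∀ a z, d (monoShift R a z) = monoShift R a (d z)) (o : σ ⊕ τ)
    (z : M ⊗[R] MonoFree R τ) :
    d.lTensor M (tensorOp M c o z) = tensorOp M c o (d.lTensor M z) := by
  rcases o with a | b
  · exact map_smul (d.lTensor M) (c a) z
  · suffices h : d.lTensor M ∘ₗ (varShift R b).lTensor M = (varShift R b).lTensor M ∘ₗ d.lTensor M
      from LinearMap.congr_fun h z
    rw [← LinearMap.lTensor_comp, ← LinearMap.lTensor_comp]
    exact congrArg _ (LinearMap.ext fun z => hd {b} z)

lemma isStableFamily_tensorCycles (c : σ → R) (s : FreeShape) {d : Module.End R (MonoFree R τ)}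
    (hd : ∀ a z, d (monoShift R a z) = monoShift R a (d z)) :
    IsStableFamily (tensorOp M c) tensorDeg (tensorCycles (M := M) c s d) := fun o δ z hz => by
  refine ⟨?_, isStableFamily_tensorPiece c s o δ z hz.2⟩
  have hz1 : d.lTensor M z = 0 := hz.1
  rw [SetLike.mem_coe, LinearMap.mem_ker, tensorOp_lTensor c hd, hz1, map_zero]

lemma isStableFamily_tensorBoundaries (c : σ → R) (s : FreeShape)
    {d : Module.End R (MonoFree R τ)} (hd : ∀ a z, d (monoShift R a z) = monoShift R a (d z)) :
    IsStableFamily (tensorOp M c) tensorDeg (tensorBoundaries (M := M) c s d) := by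
  rintro o δ _ ⟨z, hz, rfl⟩
  exact ⟨_, isStableFamily_tensorPiece c s o δ z hz, tensorOp_lTensor c hd o z⟩

lemma tensorBoundaries_le (c : σ → R) {s s' : FreeShape} {d d' : Module.End R (MonoFree R τ)}
    (h : ∀ m, (s'.piece R τ m).map d' ≤ LinearMap.ker d ⊓ s.piece R τ m) (δ : ℕ × ℕ) :
    tensorBoundaries (M := M) c s' d' δ ≤ tensorCycles c s d δ := by
  refine Submodule.map_le_iff_le_comap.2 (tensorPiece_le fun x hx y hy => ?_)
  have hy' := h _ (Submodule.mem_map_of_mem hy)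
  have hy1 : d (d' y) = 0 := hy'.1
  refine ⟨?_, tmul_mem_tensorPiece hx hy'.2⟩
  rw [SetLike.mem_coe, LinearMap.mem_ker, LinearMap.lTensor_tmul, LinearMap.lTensor_tmul, hy1,
    TensorProduct.tmul_zero]

/-- The lengths of the homology of the tensor product complex are eventually polynomial. -/
theorem isEventuallyPoly_tensorHomology [IsNoetherianRing R] [Finite σ] [Finite τ]
    [Module.Finite R M] (c : σ → R) {s s' : FreeShape} {d d' : Module.End R (MonoFree R τ)}
    (hd : ∀ a z, d (monoShift R a z) = monoShift R a (d z))
    (hd' : ∀ a z, d' (monoShift R a z) = monoShift R a (d' z))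
    (h : ∀ m, (s'.piece R τ m).map d' ≤ LinearMap.ker d ⊓ s.piece R τ m)
    (hfin : ∃ N, ∀ δ : ℕ × ℕ, N ≤ δ.1 → N ≤ δ.2 →
      relLength (tensorBoundaries (M := M) c s' d' δ) (tensorCycles c s d δ) ≠ ⊤) :
    IsEventuallyPoly fun δ =>
      ((relLength (tensorBoundaries (M := M) c s' d' δ) (tensorCycles c s d δ)).toNat : ℚ) := by
  have := Fintype.ofFinite (σ ⊕ τ)
  have hQ := isStableFamily_tensorCycles (M := M) c s hd
  exact isEventuallyPoly_relLength (tensorOp_commute M c) tensorDeg_eq _ _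
    (isStableFamily_tensorBoundaries c s' hd') hQ (tensorBoundaries_le c h)
    ((fgFamily_tensorPiece c s).of_le (tensorOp_commute M c) hQ fun δ => inf_le_right) hfin

end TensorFamily

section ProjectiveResolutionOf

open Limits

/-- A projective resolution from a sequence of composable maps. -/
noncomputable def ProjectiveResolution.ofSequence {C : Type*} [Category C] [Abelian C] (Z : C)
    (X : ℕ → C) [∀ n, Projective (X n)] (d : ∀ n, X (n + 1) ⟶ X n)
    (sq : ∀ n, d (n + 1) ≫ d n = 0) (π : X 0 ⟶ Z) [Epi π] (w : d 0 ≫ π = 0)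
    (h₀ : (ShortComplex.mk (d 0) π w).Exact)
    (h : ∀ n, (ShortComplex.mk (d (n + 1)) (d n) (sq n)).Exact) : ProjectiveResolution Z where
  complex := ChainComplex.of X d sq
  projective n := inferInstanceAs (Projective (X n))
  π := (ChainComplex.toSingle₀Equiv (ChainComplex.of X d sq) Z).symm
    ⟨π, (congrArg (· ≫ π) (ChainComplex.of_d X d 0)).trans w⟩
  quasiIso := ⟨fun n => by
    cases n with
    | zero =>
      rw [ChainComplex.quasiIsoAt₀_iff, ShortComplex.quasiIso_iff_of_zeros']
      · refine (ShortComplex.exact_and_epi_g_iff_of_iso ?_).2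
          ⟨h₀, by dsimp; infer_instance⟩
        refine ShortComplex.isoMk (Iso.refl _) (Iso.refl _) (Iso.refl _) ?_ ?_
        · exact (Category.id_comp _).trans ((ChainComplex.of_d X d 0).symm.trans
            (Category.comp_id _).symm)
        · refine (Category.id_comp _).trans (Eq.trans ?_ (Category.comp_id _).symm)
          exact (ChainComplex.toSingle₀Equiv_symm_apply_f_zero (C := ChainComplex.of X d sq) (X := Z)
            π
            ((congrArg (· ≫ π) (ChainComplex.of_d X d 0)).trans w)).symm
      all_goals rfl
    | succ n =>
      rw [quasiIsoAt_iff_exactAt']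
      · rw [HomologicalComplex.exactAt_iff' _ (n + 2) (n + 1) n (by simp) (by simp)]
        refine (ShortComplex.exact_iff_of_iso ?_).2 (h n)
        refine ShortComplex.isoMk (Iso.refl _) (Iso.refl _) (Iso.refl _) ?_ ?_
        · exact (Category.id_comp _).trans ((ChainComplex.of_d X d (n + 1)).symm.trans
            (Category.comp_id _).symm)
        · exact (Category.id_comp _).trans ((ChainComplex.of_d X d n).symm.trans
            (Category.comp_id _).symm)
      · apply ChainComplex.exactAt_succ_single_obj⟩

lemma ProjectiveResolution.ofSequence_d {C : Type*} [Category C] [Abelian C] (Z : C)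
    (X : ℕ → C) [∀ n, Projective (X n)] (d : ∀ n, X (n + 1) ⟶ X n)
    (sq : ∀ n, d (n + 1) ≫ d n = 0) (π : X 0 ⟶ Z) [Epi π] (w : d 0 ≫ π = 0)
    (h₀ : (ShortComplex.mk (d 0) π w).Exact)
    (h : ∀ n, (ShortComplex.mk (d (n + 1)) (d n) (sq n)).Exact) (n : ℕ) :
    (ofSequence Z X d sq π w h₀ h).complex.d (n + 1) n = d n :=
  ChainComplex.of_d X d n

variable {R : Type} [CommRing R]

lemma length_homology_moduleCat (S : ShortComplex (ModuleCat.{0} R)) :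
    Module.length R S.homology =
      relLength (LinearMap.range S.f.hom) (LinearMap.ker S.g.hom) := by
  rw [(S.moduleCatHomologyIso.toLinearEquiv).length_eq]
  refine (relLength_eq_of_surjective (LinearMap.range S.moduleCatToCycles).mkQ
    (Submodule.mkQ_surjective _) fun z => ?_).symm
  rw [Submodule.mkQ_apply, Submodule.Quotient.mk_eq_zero]
  constructor
  · rintro ⟨y, hy⟩
    exact ⟨y, congrArg Subtype.val hy⟩
  · rintro ⟨y, hy⟩
    exact ⟨y, Subtype.ext hy⟩

lemma length_TorM (i : ℕ) (X : Type) [AddCommGroup X] [Module R X] (Y : Type) [AddCommGroup Y]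
    [Module R Y] (P : ProjectiveResolution (ModuleCat.of R Y)) :
    Module.length R (TorM R i X Y) =
      relLength (LinearMap.range ((P.complex.d (i + 1) i).hom.lTensor X))
        (LinearMap.ker ((P.complex.d i (i - 1)).hom.lTensor X)) := by
  let F := (MonoidalCategory.tensoringLeft (ModuleCat.{0} R)).obj (ModuleCat.of R X)
  let K := (F.mapHomologicalComplex (ComplexShape.down ℕ)).obj P.complex
  have e : TorM R i X Y ≅ (K.sc' (i + 1) i (i - 1)).homology :=
    P.isoLeftDerivedObj F i ≪≫ ShortComplex.homologyMapIso
      (K.isoSc' (i + 1) i (i - 1) (by simp) (by cases i <;> simp))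
  rw [e.toLinearEquiv.length_eq]
  exact length_homology_moduleCat _

end ProjectiveResolutionOf

section TorOfSubmodules

open TensorProduct

variable {R E M N : Type} [CommRing R] [AddCommGroup E] [Module R E] [AddCommGroup M] [Module R M]
  [AddCommGroup N] [Module R N]

/-- `Tor` computed inside an ambient module, when the resolution consists of free submodules of a
fixed module. -/
theorem length_TorM_of_submodules (A : ℕ → Submodule R E) [∀ j, Module.Free R (A j)]
    (d : ℕ → Module.End R E) (ε : E →ₗ[R] N) (Z : Submodule R N)
    (hε : (A 0).map ε = Z) (h₁ : (A 1).map (d 1) = LinearMap.ker ε ⊓ A 0)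
    (h₂ : ∀ j, (A (j + 2)).map (d (j + 2)) = LinearMap.ker (d (j + 1)) ⊓ A (j + 1))
    (h₀ : d 0 = 0) (X : Submodule R M)
    (hinj : ∀ j, Function.Injective (TensorProduct.mapIncl X (A j))) (i : ℕ) :
    Module.length R (TorM R i X Z) =
      relLength ((LinearMap.range (TensorProduct.mapIncl X (A (i + 1)))).map
        ((d (i + 1)).lTensor M))
        (LinearMap.ker ((d i).lTensor M) ⊓ LinearMap.range (TensorProduct.mapIncl X (A i))) := by
  have hd : ∀ j, ∀ z ∈ A (j + 1), d (j + 1) z ∈ A j := fun j z hz => by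
    cases j with
    | zero => exact (h₁.le (Submodule.mem_map_of_mem hz)).2
    | succ j => exact ((h₂ j).le (Submodule.mem_map_of_mem hz)).2
  let D : ∀ j, A (j + 1) →ₗ[R] A j := fun j => (d (j + 1)).restrict (hd j)
  let ε' : A 0 →ₗ[R] Z := ε.restrict fun z hz => hε.le (Submodule.mem_map_of_mem hz)
  have hε' : Function.Surjective ε' := fun z => by
    obtain ⟨y, hy, hyz⟩ := hε.ge z.2
    exact ⟨⟨y, hy⟩, Subtype.ext hyz⟩
  have hex₀ : LinearMap.range (D 0) = LinearMap.ker ε' := by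
    ext z
    have := SetLike.ext_iff.1 h₁ (z : E)
    simp only [Submodule.mem_map, Submodule.mem_inf, LinearMap.mem_ker, z.2, and_true] at this
    simp only [LinearMap.mem_range, LinearMap.mem_ker, Subtype.ext_iff, Subtype.exists, D, ε']
    simpa using this
  have hex : ∀ j, LinearMap.range (D (j + 1)) = LinearMap.ker (D j) := fun j => by
    ext z
    have := SetLike.ext_iff.1 (h₂ j) (z : E)
    simp only [Submodule.mem_map, Submodule.mem_inf, LinearMap.mem_ker, z.2, and_true] at this
    simp only [LinearMap.mem_range, LinearMap.mem_ker, Subtype.ext_iff, Subtype.exists, D]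
    simpa using this
  have : Epi (ModuleCat.ofHom ε') := (ModuleCat.epi_iff_surjective _).2 hε'
  have : ∀ j, Projective (ModuleCat.of R (A j)) := fun j =>
    (ModuleCat.of R (A j)).projective_of_categoryTheory_projective
  let P : ProjectiveResolution (ModuleCat.of R Z) :=
    ProjectiveResolution.ofSequence (ModuleCat.of R Z) (fun j => ModuleCat.of R (A j))
      (fun j => ModuleCat.ofHom (D j))
      (fun j => by
        rw [← ModuleCat.ofHom_comp, LinearMap.range_le_ker_iff.1 (hex j).le]; rfl)
      (ModuleCat.ofHom ε')
      (by rw [← ModuleCat.ofHom_comp, LinearMap.range_le_ker_iff.1 hex₀.le]; rfl)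
      ((ShortComplex.moduleCat_exact_iff_range_eq_ker _).2 hex₀)
      (fun j => (ShortComplex.moduleCat_exact_iff_range_eq_ker _).2 (hex j))
  have hPd : ∀ j, P.complex.d (j + 1) j = ModuleCat.ofHom (D j) := fun j =>
    ProjectiveResolution.ofSequence_d ..
  have hcomm : ∀ j (z : X ⊗[R] A (j + 1)), TensorProduct.mapIncl X (A j) ((D j).lTensor X z) =
      (d (j + 1)).lTensor M (TensorProduct.mapIncl X (A (j + 1)) z) := fun j z => by
    induction z with
    | zero => simp only [map_zero]
    | tmul x y => rfl
    | add z z' h h' => simp only [map_add, h, h']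
  have hker : ∀ z : X ⊗[R] A i, ((P.complex.d i (i - 1)).hom.lTensor X) z = 0 ↔
      (d i).lTensor M (TensorProduct.mapIncl X (A i) z) = 0 := fun z => by
    cases i with
    | zero =>
      rw [P.complex.shape 0 0 (by simp), h₀]
      rw [LinearMap.lTensor_zero, LinearMap.zero_apply]
      exact iff_of_true (LinearMap.congr_fun (LinearMap.lTensor_zero _) z) rfl
    | succ j =>
      change ((P.complex.d (j + 1) j).hom.lTensor X) z = 0 ↔ _
      rw [hPd, ← hcomm, ← map_zero (TensorProduct.mapIncl X (A j)), (hinj j).eq_iff]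
      rfl
  have hdd : ∀ z : X ⊗[R] A (i + 1), (d i).lTensor M
      ((d (i + 1)).lTensor M (TensorProduct.mapIncl X (A (i + 1)) z)) = 0 := fun z => by
    induction z with
    | zero => simp only [map_zero]
    | tmul x y =>
      have : d i (d (i + 1) y) = 0 := by
        cases i with
        | zero => rw [h₀, LinearMap.zero_apply]
        | succ j => exact ((h₂ j).le (Submodule.mem_map_of_mem y.2)).1
      simp [TensorProduct.mapIncl, this]
    | add z z' h h' => simp only [map_add, h, h', add_zero]
  rw [length_TorM i X Z P]
  refine relLength_eq_of_map (TensorProduct.mapIncl X (A i)) ?_ fun z _ => ?_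
  · refine le_antisymm ?_ (sup_le ?_ ?_)
    · rintro _ ⟨hz, y, rfl⟩
      exact Submodule.mem_sup_left ⟨y, (hker y).2 hz, rfl⟩
    · rintro _ ⟨y, hy, rfl⟩
      exact ⟨(hker y).1 hy, y, rfl⟩
    · rintro _ ⟨_, ⟨y, rfl⟩, rfl⟩
      exact ⟨hdd y, _, hcomm i y⟩
  · rw [hPd]
    constructor
    · rintro ⟨_, ⟨y, rfl⟩, hy⟩
      rw [← hcomm] at hy
      exact ⟨y, hinj i hy⟩
    · rintro ⟨y, rfl⟩
      exact ⟨_, ⟨y, rfl⟩, (hcomm i y).symm⟩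

end TorOfSubmodules

section Assembly

open TensorProduct

lemma injective_mapIncl_piece {R τ M : Type} [CommRing R] [AddCommGroup M] [Module R M]
    (X : Submodule R M) (s : FreeShape) (m : ℕ) :
    Function.Injective (TensorProduct.mapIncl X (s.piece R τ m)) := by
  classical
  have h : TensorProduct.mapIncl X (s.piece R τ m) =
      X.subtype.rTensor (MonoFree R τ) ∘ₗ (s.piece R τ m).subtype.lTensor X :=
    (LinearMap.rTensor_comp_lTensor ..).symm
  rw [h, LinearMap.coe_comp]
  refine (Module.Flat.rTensor_preserves_injective_linearMap _ X.injective_subtype).comp ?_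
  obtain ⟨r, hr⟩ : ∃ r : MonoFree R τ →ₗ[R] s.piece R τ m,
      r ∘ₗ (s.piece R τ m).subtype = LinearMap.id :=
    ⟨Finsupp.restrictDom R R _, Finsupp.restrictDom_comp_subtype _⟩
  refine Function.LeftInverse.injective (g := r.lTensor X) fun z => ?_
  rw [← LinearMap.comp_apply, ← LinearMap.lTensor_comp, hr, LinearMap.lTensor_id,
    LinearMap.id_apply]

lemma exists_span_range_eq {R : Type} [CommRing R] [IsNoetherianRing R] (I : Ideal R) :
    ∃ (n : ℕ) (c : Fin n → R), Ideal.span (Set.range c) = I :=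
  Submodule.fg_iff_exists_fin_generating_family.1 (IsNoetherian.noetherian I)

end Assembly

theorem stmt13 (R : Type) [CommRing R] [IsNoetherianRing R]
    (I J : Ideal R)
    (M : Type) [AddCommGroup M] [Module R M] [Module.Finite R M]
    (N : Type) [AddCommGroup N] [Module R N] [Module.Finite R N]
    (i : ℕ)
    (hfin : ∃ m₁ n₁ : ℕ, ∀ m, m₁ ≤ m → ∀ n, n₁ ≤ n →
      IsFiniteLength R ↥(TorM R i (↥(I ^ n • (⊤ : Submodule R M)))
        (↥(J ^ m • (⊤ : Submodule R N))))) :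
    ∃ (p : MvPolynomial (Fin 2) ℚ) (m₀ n₀ : ℕ), ∀ m, m₀ ≤ m → ∀ n, n₀ ≤ n →
      ∃ c : ℕ,
        modLength R ↥(TorM R i (↥(I ^ n • (⊤ : Submodule R M)))
          (↥(J ^ m • (⊤ : Submodule R N)))) = (c : ℕ∞) ∧
        (c : ℚ) = MvPolynomial.eval ![(m : ℚ), (n : ℚ)] p := by
  obtain ⟨a, c, rfl⟩ := exists_span_range_eq I
  obtain ⟨b, f, rfl⟩ := exists_span_range_eq J
  obtain ⟨s, d, ε, hε, h₁, h₂, h₀, hd⟩ := exists_graded_resolution f N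
  have hlen : ∀ m n, Module.length R (TorM R i
      (Ideal.span (Set.range c) ^ n • (⊤ : Submodule R M) : Submodule R M)
      (Ideal.span (Set.range f) ^ m • (⊤ : Submodule R N) : Submodule R N)) =
      relLength (tensorBoundaries (M := M) c (s (i + 1)) (d (i + 1)) (m, n))
        (tensorCycles c (s i) (d i) (m, n)) := fun m n =>
    length_TorM_of_submodules (fun j => (s j).piece R (Fin b) m) d ε _ (hε m) (h₁ m)
      (fun j => h₂ j m) h₀ _ (fun j => injective_mapIncl_piece _ (s j) m) i
  have hmap : ∀ m, ((s (i + 1)).piece R (Fin b) m).map (d (i + 1)) ≤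
      LinearMap.ker (d i) ⊓ (s i).piece R (Fin b) m := fun m => by
    cases i with
    | zero => rw [h₁, h₀, LinearMap.ker_zero]; exact inf_le_inf_right _ le_top
    | succ j => exact (h₂ j m).le
  obtain ⟨m₁, n₁, hfin⟩ := hfin
  have hne : ∀ m, m₁ ≤ m → ∀ n, n₁ ≤ n →
      relLength (tensorBoundaries (M := M) c (s (i + 1)) (d (i + 1)) (m, n))
        (tensorCycles c (s i) (d i) (m, n)) ≠ ⊤ := fun m hm n hn =>
    hlen m n ▸ Module.length_ne_top_iff.2 (hfin m hm n hn)
  obtain ⟨g, ⟨p, hp⟩, N₀, hg⟩ := isEventuallyPoly_tensorHomology c (hd i) (hd (i + 1)) hmap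
    ⟨max m₁ n₁, fun δ h h' => hne δ.1 (le_of_max_le_left h) δ.2 (le_of_max_le_right h')⟩
  refine ⟨p, max m₁ N₀, max n₁ N₀, fun m hm n hn => ⟨_, ?_,
    (hg (m, n) (le_of_max_le_right hm) (le_of_max_le_right hn)).trans (hp (m, n))⟩⟩
  rw [modLength, ← Module.coe_length, hlen,
    ENat.natCast_toNat (hne m (le_of_max_le_left hm) n (le_of_max_le_left hn))]
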